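/- The protein folding process G in the 2D HP square lattice model is chaotic according to Devaney: G is continuous on (X, d), the set of periodic points of G is dense in X, and G is topologically transitive. -/

import Mathlib

open scoped BigOperators

/-- Absolute-encoding conformations of a protein with `N+1` residues:
maps `{1,…,N} → {1,2,3,4}`, encoded with `Fin N → Fin 4`
(index `j : Fin N` is residue `j+1`, value `v : Fin 4` is direction `v+1`). -/
abbrev Conformation (N : ℕ) := Fin N → Fin 4

/-- A single fold instruction: an integer `k` with `|k| ≤ N`. -/
abbrev FoldVal (N : ℕ) := {k : ℤ // |k| ≤ (N : ℤ)}

/-- Folding sequences `F : ℕ → [−N, N] ∩ ℤ`. -/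
abbrev FoldSeq (N : ℕ) := ℕ → FoldVal N

/-- The phase space `𝒳` of the 2D HP protein folding process. -/
abbrev PhaseSpace (N : ℕ) := Conformation N × FoldSeq N

/-- Distance between conformations: `d_C(C,C') = Σ_{k=1}^N δ(C_k,C'_k)·2^{N−k}`. -/
noncomputable def dC (N : ℕ) (C C' : Conformation N) : ℝ :=
  ∑ k : Fin N, (if C k = C' k then 0 else 1) * 2 ^ (N - ((k : ℕ) + 1))

/-- Distance between folding sequences:
`d_F(F,F') = (9/(2N))·Σ_{k=0}^∞ |F(k) − F'(k)|/10^{k+1}`. -/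
noncomputable def dF (N : ℕ) (F F' : FoldSeq N) : ℝ :=
  ((9 : ℝ) / (2 * N)) * ∑' k : ℕ, |((F k : ℤ) : ℝ) - ((F' k : ℤ) : ℝ)| / 10 ^ (k + 1)

/-- The distance on the phase space: `d((C,F),(C',F')) = d_C(C,C') + d_F(F,F')`. -/
noncomputable def dX (N : ℕ) (X Y : PhaseSpace N) : ℝ :=
  dC N X.1 Y.1 + dF N X.2 Y.2

/-- The clockwise fold function `f : 1↦4, 2↦3, 3↦1, 4↦2` (0-indexed: `0↦3, 1↦2, 2↦0, 3↦1`). -/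
def foldClockwise : Fin 4 → Fin 4 := ![3, 2, 0, 1]

/-- The anticlockwise fold function `f⁻¹ : 4↦1, 3↦2, 1↦3, 2↦4`
(0-indexed: `0↦2, 1↦3, 2↦1, 3↦0`). -/
def foldAnticlockwise : Fin 4 → Fin 4 := ![2, 3, 1, 0]

/-- `f^{sign(k)}`: the clockwise fold if `k > 0`, the anticlockwise fold if `k < 0`,
the identity if `k = 0`. -/
def foldPow (k : ℤ) : Fin 4 → Fin 4 :=
  if 0 < k then foldClockwise else if k < 0 then foldAnticlockwise else id

/-- The map `f_k`, acting on a conformation by applying `f^{sign(k)}` to every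
coordinate `≥ |k|` (1-based) and keeping the coordinates `< |k|` unchanged. -/
def foldMap (N : ℕ) (k : ℤ) (C : Conformation N) : Conformation N :=
  fun j => if (((j : ℕ) + 1 : ℤ)) < |k| then C j else foldPow k (C j)

/-- The protein folding map `G(C,F) = (f_{i(F)}(C), σ(F))` where `i(F) = F(0)`
and `σ` is the shift. -/
def G (N : ℕ) (X : PhaseSpace N) : PhaseSpace N :=
  (foldMap N (X.2 0).1 X.1, fun n => X.2 (n + 1))

/-- The fold instruction `0` (no fold). -/
def zeroFold (N : ℕ) : FoldVal N := ⟨0, by simp⟩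

/-- `U ⊆ 𝒳` is open for the metric `d`. -/
def IsOpenD (N : ℕ) (U : Set (PhaseSpace N)) : Prop :=
  ∀ x ∈ U, ∃ ε > 0, ∀ y, dX N x y < ε → y ∈ U

/-! ### Distance on folding sequences -/

lemma aux_summable (N : ℕ) (F F' : FoldSeq N) :
    Summable (fun k : ℕ => |((F k : ℤ) : ℝ) - ((F' k : ℤ) : ℝ)| / 10 ^ (k + 1)) := by
  have hg : Summable (fun k : ℕ => (2 * (N : ℝ) / 10) * (1 / 10 : ℝ) ^ k) :=
    (summable_geometric_of_lt_one (by norm_num) (by norm_num)).mul_left _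
  refine Summable.of_nonneg_of_le (fun k => by positivity) (fun k => ?_) hg
  have hb : |((F k : ℤ) : ℝ) - ((F' k : ℤ) : ℝ)| ≤ 2 * N := by
    have h1 : |((F k : ℤ) : ℝ)| ≤ N := by exact_mod_cast (F k).2
    have h2 : |((F' k : ℤ) : ℝ)| ≤ N := by exact_mod_cast (F' k).2
    have := abs_sub ((F k : ℤ) : ℝ) ((F' k : ℤ) : ℝ)
    linarith
  calc _ ≤ 2 * (N : ℝ) / 10 ^ (k + 1) := by gcongr
    _ = _ := by rw [one_div, inv_pow, pow_succ]; field_simp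

lemma dF_nonneg' (N : ℕ) (F F' : FoldSeq N) : 0 ≤ dF N F F' := by
  unfold dF
  exact mul_nonneg (by positivity) (tsum_nonneg fun k => by positivity)

lemma dF_le_one (N : ℕ) (hN : 1 ≤ N) (F F' : FoldSeq N) : dF N F F' ≤ 1 := by
  have hN' : (0 : ℝ) < N := by exact_mod_cast hN
  have hg : HasSum (fun k : ℕ => (2 * (N : ℝ) / 10) * (1 / 10 : ℝ) ^ k)
      ((2 * (N : ℝ) / 10) * (1 - 1 / 10)⁻¹) :=
    (hasSum_geometric_of_lt_one (by norm_num) (by norm_num)).mul_left _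
  have hle : (∑' k : ℕ, |((F k : ℤ) : ℝ) - ((F' k : ℤ) : ℝ)| / 10 ^ (k + 1))
      ≤ (2 * (N : ℝ) / 10) * (1 - 1 / 10)⁻¹ := by
    rw [← hg.tsum_eq]
    refine Summable.tsum_le_tsum (fun k => ?_) (aux_summable N F F') hg.summable
    have hb : |((F k : ℤ) : ℝ) - ((F' k : ℤ) : ℝ)| ≤ 2 * N := by
      have h1 : |((F k : ℤ) : ℝ)| ≤ N := by exact_mod_cast (F k).2
      have h2 : |((F' k : ℤ) : ℝ)| ≤ N := by exact_mod_cast (F' k).2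
      have := abs_sub ((F k : ℤ) : ℝ) ((F' k : ℤ) : ℝ)
      linarith
    calc _ ≤ 2 * (N : ℝ) / 10 ^ (k + 1) := by gcongr
      _ = _ := by rw [one_div, inv_pow, pow_succ]; field_simp
  unfold dF
  calc _ ≤ (9 : ℝ) / (2 * N) * ((2 * (N : ℝ) / 10) * (1 - 1 / 10)⁻¹) := by gcongr
    _ = 1 := by norm_num; field_simp

lemma dF_rec (N : ℕ) (F F' : FoldSeq N) :
    dF N F F' = (9 : ℝ) / (20 * N) * |((F 0 : ℤ) : ℝ) - ((F' 0 : ℤ) : ℝ)|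
      + dF N (fun n => F (n + 1)) (fun n => F' (n + 1)) / 10 := by
  unfold dF
  rw [(aux_summable N F F').tsum_eq_zero_add]
  have : (∑' k : ℕ, |((F (k + 1) : ℤ) : ℝ) - ((F' (k + 1) : ℤ) : ℝ)| / 10 ^ (k + 1 + 1))
      = (∑' k : ℕ, |((F (k + 1) : ℤ) : ℝ) - ((F' (k + 1) : ℤ) : ℝ)| / 10 ^ (k + 1)) / 10 := by
    rw [← tsum_div_const]
    refine tsum_congr fun k => ?_
    rw [pow_succ _ (k + 1), div_div]
  rw [this, show (9 : ℝ) / (20 * N) = 9 / (2 * N) / 10 by rw [div_div]; ring_nf]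
  ring

lemma dC_self' (N : ℕ) (C : Conformation N) : dC N C C = 0 := by simp [dC]

lemma dC_nonneg' (N : ℕ) (C C' : Conformation N) : 0 ≤ dC N C C' := by
  unfold dC
  refine Finset.sum_nonneg fun k _ => ?_
  split_ifs <;> simp

lemma eq_of_dC_lt (N : ℕ) (C C' : Conformation N) (h : dC N C C' < 1) : C = C' := by
  by_contra hne
  obtain ⟨j, hj⟩ := Function.ne_iff.mp hne
  have h1 : ((if C j = C' j then (0 : ℝ) else 1) * 2 ^ (N - ((j : ℕ) + 1))) ≤ dC N C C' := by
    unfold dC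
    refine Finset.single_le_sum (f := fun k : Fin N =>
      (if C k = C' k then (0 : ℝ) else 1) * 2 ^ (N - ((k : ℕ) + 1))) (fun k _ => ?_)
      (Finset.mem_univ j)
    split_ifs <;> simp
  rw [if_neg hj, one_mul] at h1
  have h2 : (1 : ℝ) ≤ 2 ^ (N - ((j : ℕ) + 1)) := one_le_pow₀ (by norm_num)
  linarith

/-! ### Words of folds -/

/-- Prepend a finite word to a folding sequence. -/
def app {N : ℕ} : List (FoldVal N) → FoldSeq N → FoldSeq N
  | [], F => F
  | a :: L, F => fun n => Nat.casesOn n a (app L F)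

/-- Action of a finite word on a conformation. -/
def act {N : ℕ} : List (FoldVal N) → Conformation N → Conformation N
  | [], C => C
  | a :: L, C => act L (foldMap N a.1 C)

/-- Prefix of a folding sequence. -/
def pre {N : ℕ} : FoldSeq N → ℕ → List (FoldVal N)
  | _, 0 => []
  | F, n + 1 => F 0 :: pre (fun k => F (k + 1)) n

lemma pre_length {N : ℕ} (n : ℕ) : ∀ F : FoldSeq N, (pre F n).length = n := by
  induction n with
  | zero => intro F; rfl
  | succ n ih => intro F; simp [pre, ih]

lemma act_append {N : ℕ} (L M : List (FoldVal N)) :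
    ∀ C, act (L ++ M) C = act M (act L C) := by
  induction L with
  | nil => intro C; rfl
  | cons a L ih => intro C; exact ih _

lemma app_append {N : ℕ} (L M : List (FoldVal N)) (F : FoldSeq N) :
    app (L ++ M) F = app L (app M F) := by
  induction L with
  | nil => rfl
  | cons a L ih => simp only [List.cons_append, app, ih]

lemma G_iter {N : ℕ} (L : List (FoldVal N)) (F : FoldSeq N) :
    ∀ C, (G N)^[L.length] (C, app L F) = (act L C, F) := by
  induction L with
  | nil => intro C; rfl
  | cons a L ih =>
    intro C
    rw [List.length_cons, Function.iterate_succ_apply]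
    exact ih _

lemma dF_pre (N : ℕ) (hN : 1 ≤ N) (H : FoldSeq N) (n : ℕ) :
    ∀ F : FoldSeq N, dF N F (app (pre F n) H) ≤ (1 / 10 : ℝ) ^ n := by
  induction n with
  | zero => intro F; simpa using dF_le_one N hN _ _
  | succ n ih =>
    intro F
    rw [dF_rec]
    have h := ih (fun k => F (k + 1))
    change 9 / (20 * (N : ℝ)) * |((F 0 : ℤ) : ℝ) - ((F 0 : ℤ) : ℝ)|
      + dF N (fun k => F (k + 1)) (app (pre (fun k => F (k + 1)) n) H) / 10 ≤ _
    rw [pow_succ, sub_self, abs_zero, mul_zero]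
    linarith

lemma app_periodic {N : ℕ} (L : List (FoldVal N)) (hL : 0 < L.length) :
    ∃ P : FoldSeq N, app L P = P := by
  have key : ∀ (L : List (FoldVal N)) (F : FoldSeq N) (k : ℕ),
      app L F k = if h : k < L.length then L[k] else F (k - L.length) := by
    intro L F
    induction L with
    | nil => intro k; simp [app]
    | cons a L ih =>
      intro k
      cases k with
      | zero => simp [app]
      | succ k => simp [app, ih]
  refine ⟨fun k => L[k % L.length]'(Nat.mod_lt _ hL), ?_⟩
  funext k
  rw [key]
  split_ifs with h
  · simp only [Nat.mod_eq_of_lt h]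
  · simp only [← Nat.mod_eq_sub_mod (not_lt.mp h)]

lemma cyc : ∀ a b : Fin 4, ∃ t : Fin 4, foldClockwise^[t.1] a = b := by decide

lemma act_replicate {N : ℕ} (m : ℕ) (hm : m + 1 ≤ N) (a : FoldVal N)
    (ha : a.1 = ((m + 1 : ℕ) : ℤ)) (t : ℕ) : ∀ (C : Conformation N) (j : Fin N),
    act (List.replicate t a) C j
      = if (j : ℕ) < m then C j else foldClockwise^[t] (C j) := by
  induction t with
  | zero => intro C j; simp [act]
  | succ t ih =>
    intro C j
    rw [List.replicate_succ, act, ih, ha]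
    have h1 : |((m + 1 : ℕ) : ℤ)| = m + 1 := by rw [abs_of_nonneg] <;> push_cast <;> omega
    have h2 : (0 : ℤ) < ((m + 1 : ℕ) : ℤ) := by omega
    unfold foldMap foldPow
    rw [h1, if_pos h2]
    by_cases hj : (j : ℕ) < m
    · have : ((j : ℕ) : ℤ) + 1 < m + 1 := by omega
      simp [hj]
    · have : ¬ ((j : ℕ) : ℤ) + 1 < m + 1 := by omega
      rw [if_neg hj, if_neg hj, if_neg this, Function.iterate_succ_apply]

lemma reach {N : ℕ} (C C' : Conformation N) : ∃ L : List (FoldVal N), act L C = C' := by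
  have key : ∀ m ≤ N, ∃ L : List (FoldVal N), ∀ j : Fin N, (j : ℕ) < m → act L C j = C' j := by
    intro m
    induction m with
    | zero => intro _; exact ⟨[], fun j hj => absurd hj (Nat.not_lt_zero _)⟩
    | succ m ih =>
      intro hm
      obtain ⟨L, hL⟩ := ih (by omega)
      obtain ⟨t, ht⟩ := cyc (act L C ⟨m, hm⟩) (C' ⟨m, hm⟩)
      let a : FoldVal N := ⟨((m + 1 : ℕ) : ℤ), by rw [abs_of_nonneg] <;> omega⟩
      refine ⟨L ++ List.replicate t.1 a, fun j hj => ?_⟩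
      rw [act_append, act_replicate m hm a rfl]
      split_ifs with h
      · exact hL j h
      · have : j = ⟨m, hm⟩ := Fin.ext (by simp only; omega)
        rw [this]; exact ht
  obtain ⟨L, hL⟩ := key N le_rfl
  exact ⟨L, funext fun j => hL j j.2⟩

lemma exists_pow_small (ε : ℝ) (hε : 0 < ε) : ∃ n : ℕ, (1 / 10 : ℝ) ^ (n + 1) < ε := by
  obtain ⟨n, hn⟩ := exists_pow_lt_of_lt_one hε (by norm_num : (1 / 10 : ℝ) < 1)
  refine ⟨n, lt_of_le_of_lt ?_ hn⟩
  exact pow_le_pow_of_le_one (by norm_num) (by norm_num) (Nat.le_succ n)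

/-- the protein folding process `G` in the 2D HP square lattice model
is chaotic according to Devaney: `G` is continuous on `(𝒳, d)`, its periodic points
are dense, and it is topologically transitive. -/
theorem folding_devaney_chaotic (N : ℕ) (hN : 1 ≤ N) :
    (∀ X : PhaseSpace N, ∀ ε : ℝ, 0 < ε → ∃ δ : ℝ, 0 < δ ∧
      ∀ Y : PhaseSpace N, dX N X Y < δ → dX N (G N X) (G N Y) < ε) ∧
    (∀ X : PhaseSpace N, ∀ ε : ℝ, 0 < ε →
      ∃ X' : PhaseSpace N, (∃ n : ℕ, 1 ≤ n ∧ (G N)^[n] X' = X') ∧ dX N X X' < ε) ∧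
    (∀ U V : Set (PhaseSpace N), IsOpenD N U → IsOpenD N V →
      U.Nonempty → V.Nonempty →
      ∃ k : ℕ, 1 ≤ k ∧ ((G N)^[k] '' U ∩ V).Nonempty) := by
  have hN' : (0 : ℝ) < N := by exact_mod_cast hN
  refine ⟨?_, ?_, ?_⟩
  · rintro ⟨C, F⟩ ε hε
    refine ⟨min 1 (min (9 / (20 * N)) (ε / 10)), by positivity, ?_⟩
    rintro ⟨C', F'⟩ h
    obtain ⟨h1, h23⟩ := lt_min_iff.mp h
    obtain ⟨h2, h3⟩ := lt_min_iff.mp h23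
    simp only [dX] at h1 h2 h3
    have hc := dC_nonneg' N C C'
    have hf := dF_nonneg' N F F'
    have hs := dF_nonneg' N (fun n => F (n + 1)) (fun n => F' (n + 1))
    have hr := dF_rec N F F'
    have hCC : C = C' := eq_of_dC_lt N C C' (by linarith)
    have hpos : (0 : ℝ) < 9 / (20 * N) := by positivity
    have hlt : |((F 0 : ℤ) : ℝ) - ((F' 0 : ℤ) : ℝ)| < 1 := by
      by_contra hge
      have := le_mul_of_one_le_right hpos.le (not_lt.mp hge)
      linarith
    have h0 : F 0 = F' 0 := by
      have h4 : |(F 0 : ℤ) - (F' 0 : ℤ)| < 1 := by exact_mod_cast hlt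
      exact Subtype.ext (sub_eq_zero.mp (Int.abs_lt_one_iff.mp h4))
    subst hCC
    have hm := mul_nonneg hpos.le (abs_nonneg (((F 0 : ℤ) : ℝ) - ((F' 0 : ℤ) : ℝ)))
    simp only [dX, G, h0, dC_self']
    linarith
  · rintro ⟨C, F⟩ ε hε
    obtain ⟨n, hn⟩ := exists_pow_small ε hε
    obtain ⟨M, hM⟩ := reach (act (pre F (n + 1)) C) C
    have hlen : 0 < (pre F (n + 1) ++ M).length := by
      rw [List.length_append, pre_length]; omega
    obtain ⟨P, hP⟩ := app_periodic (pre F (n + 1) ++ M) hlen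
    refine ⟨(C, P), ⟨_, hlen, ?_⟩, ?_⟩
    · have := G_iter (pre F (n + 1) ++ M) P C
      rwa [hP, act_append, hM] at this
    · simp only [dX, dC_self', zero_add]
      rw [← hP, app_append]
      exact lt_of_le_of_lt (dF_pre N hN _ _ _) hn
  · rintro U V hU - ⟨⟨C, F⟩, hx⟩ ⟨⟨C', F'⟩, hy⟩
    obtain ⟨ε, hε, hball⟩ := hU _ hx
    obtain ⟨n, hn⟩ := exists_pow_small ε hε
    obtain ⟨M, hM⟩ := reach (act (pre F (n + 1)) C) C'
    refine ⟨(pre F (n + 1) ++ M).length, ?_, (C', F'), ⟨(C, app (pre F (n + 1) ++ M) F'), ?_, ?_⟩, hy⟩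
    · rw [List.length_append, pre_length]; omega
    · apply hball
      simp only [dX, dC_self', zero_add]
      rw [app_append]
      exact lt_of_le_of_lt (dF_pre N hN _ _ _) hn
    · rw [G_iter, act_append, hM]
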